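/- Let d ≥ 1 and K ≥ 1, let μ be the Haar probability measure on the group U(d) of d×d complex unitary matrices, and let e ∈ ℂ^d be the first standard basis vector. Then ∫_{U(d)} ((Ue)(Ue)ᴴ)^{⊗K} dμ(U) = (1/(d·(d+1)·⋯·(d+K−1))) · Σ_{π ∈ S_K} M_π, where ((Ue)(Ue)ᴴ)^{⊗K} denotes the K-fold iterated Kronecker power (a matrix whose rows and columns are indexed by tuples i : Fin K → Fin d), S_K is the symmetric group on K elements, and M_π is the permutation operator with entries M_π[i, j] = 1 if i_k = j_{π(k)} for all k ∈ Fin K, and 0 otherwise. -/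

import Mathlib

open Finset Matrix MeasureTheory

section Combinatorics

/-- Functions with fibers of equal cardinality differ by a permutation of the domain. -/
theorem exists_perm_comp_eq_of_card_fiber_eq {α ι : Type*} [Fintype α] [DecidableEq ι]
    {f g : α → ι} (h : ∀ a, #{k | f k = a} = #{k | g k = a}) :
    ∃ σ : Equiv.Perm α, g ∘ σ = f := by
  let e (a : ι) : {k // f k = a} ≃ {k // g k = a} :=
    Fintype.equivOfCardEq (by simpa [Fintype.card_subtype] using h a)
  refine ⟨(Equiv.sigmaFiberEquiv f).symm.trans
    ((Equiv.sigmaCongrRight e).trans (Equiv.sigmaFiberEquiv g)), funext fun k => ?_⟩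
  exact (e (f k) ⟨k, rfl⟩).2

/-- The number of permutations carrying `j` to `i` when `i` and `j` have equal fiber counts. -/
theorem sum_perm_eq_prod_factorial {α ι : Type*} [Fintype α] [DecidableEq α] [Fintype ι]
    [DecidableEq ι] {i j : α → ι} [∀ π : Equiv.Perm α, Decidable (∀ k, i k = j (π k))]
    (h : ∀ a, #{k | i k = a} = #{k | j k = a}) :
    ∑ π : Equiv.Perm α, (if ∀ k, i k = j (π k) then (1 : ℂ) else 0) =
      ∏ a, ((#{k | j k = a}).factorial : ℂ) := by
  obtain ⟨σ, rfl⟩ := exists_perm_comp_eq_of_card_fiber_eq h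
  have key := DomMulAct.stabilizer_card j
  simp only [Fintype.card_subtype] at key
  rw [← Nat.cast_prod, ← key, Finset.card_filter, Nat.cast_sum,
    ← Equiv.sum_comp (Equiv.mulRight σ)]
  refine Finset.sum_congr rfl fun π _ => ?_
  have : (∀ k, (j ∘ σ) k = j ((Equiv.mulRight σ π) k)) ↔ j ∘ π = j := by
    constructor
    · intro H
      funext k
      simpa using (H (σ.symm k)).symm
    · intro H k
      simpa using (congrFun H (σ k)).symm
  simp only [this, Nat.cast_ite, Nat.cast_one, Nat.cast_zero]

/-- No permutation carries `j` to `i` when their fiber counts differ. -/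
theorem sum_perm_eq_zero {α ι : Type*} [Fintype α] [DecidableEq α] [DecidableEq ι]
    {i j : α → ι} [∀ π : Equiv.Perm α, Decidable (∀ k, i k = j (π k))]
    (h : (fun a => #{k | i k = a}) ≠ fun a => #{k | j k = a}) :
    ∑ π : Equiv.Perm α, (if ∀ k, i k = j (π k) then (1 : ℂ) else 0) = 0 := by
  refine Finset.sum_eq_zero fun π _ => if_neg fun H => h (funext fun a => ?_)
  exact Finset.card_equiv π (by simp [H])

theorem card_piAntidiag_univ {ι : Type*} [Fintype ι] [DecidableEq ι] (K : ℕ) :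
    #(piAntidiag (univ : Finset ι) K) = (Fintype.card ι).multichoose K := by
  rw [← map_sym_eq_piAntidiag, card_map]
  simp [← Sym.card_sym_eq_multichoose, Finset.sym_univ]

theorem prod_cast_add_eq_factorial_mul_multichoose (d K : ℕ) :
    ∏ m : Fin K, ((d : ℂ) + m) = K.factorial * d.multichoose K := by
  rw [Fin.prod_univ_eq_prod_range (fun m => (d : ℂ) + m), Nat.multichoose_eq, ← Nat.cast_mul,
    ← Nat.ascFactorial_eq_factorial_mul_choose', Nat.ascFactorial_eq_prod_range]
  push_cast
  rfl

theorem prod_comp_eq_prod_pow_card_fiber {α ι M : Type*} [Fintype α] [Fintype ι] [DecidableEq ι]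
    [CommMonoid M] (f : ι → M) (i : α → ι) :
    ∏ k, f (i k) = ∏ a, f a ^ #{k | i k = a} := by
  rw [← Finset.prod_fiberwise' univ i f]
  simp

/-- Coefficients of a multivariate polynomial are determined by its values at positive reals. -/
theorem coeff_eq_of_eval_pos_eq {ι : Type*} [Fintype ι] {S : Finset (ι → ℕ)} {A B : (ι → ℕ) → ℂ}
    (h : ∀ t : ι → ℝ, (∀ a, 0 < t a) →
      ∑ α ∈ S, A α * ∏ a, (t a : ℂ) ^ α a = ∑ α ∈ S, B α * ∏ a, (t a : ℂ) ^ α a)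
    {α : ι → ℕ} (hα : α ∈ S) : A α = B α := by
  classical
  let P (A : (ι → ℕ) → ℂ) : MvPolynomial ι ℂ :=
    ∑ α ∈ S, MvPolynomial.monomial (Finsupp.equivFunOnFinite.symm α) (A α)
  have coeff_P (A) : (P A).coeff (Finsupp.equivFunOnFinite.symm α) = A α := by
    simp [P, MvPolynomial.coeff_sum, MvPolynomial.coeff_monomial, hα]
  have hP : P A = P B := by
    refine MvPolynomial.funext_set (fun _ => Complex.ofReal '' Set.Ioi 0)
      (fun _ => (Set.Ioi_infinite 0).image Complex.ofReal_injective.injOn) fun x hx => ?_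
    choose t ht hxt using fun a => hx a (Set.mem_univ a)
    obtain rfl : (fun a => (t a : ℂ)) = x := funext hxt
    simpa [P, MvPolynomial.eval_monomial, Finsupp.prod_fintype] using h t ht
  rw [← coeff_P A, hP, coeff_P]

end Combinatorics

section UnitaryGroup

variable {ι : Type*} [Fintype ι] [DecidableEq ι]

theorem isCompact_unitaryGroup : IsCompact (Matrix.unitaryGroup ι ℂ : Set (Matrix ι ι ℂ)) := by
  have hball : IsCompact (Set.univ.pi fun _ : ι => Set.univ.pi fun _ : ι =>
      Metric.closedBall (0 : ℂ) 1) :=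
    isCompact_univ_pi fun _ => isCompact_univ_pi fun _ => isCompact_closedBall 0 1
  refine hball.of_isClosed_subset ?_ fun U hU => ?_
  · have : (Matrix.unitaryGroup ι ℂ : Set (Matrix ι ι ℂ)) = {U | U * star U = 1} := by
      ext U
      exact Matrix.mem_unitaryGroup_iff
    rw [this]
    exact isClosed_eq (by fun_prop) continuous_const
  · simpa [Set.mem_pi] using fun a b => entry_norm_bound_of_unitary hU a b

/-- Every unit vector is a prescribed row of some unitary matrix. -/
theorem exists_unitary_row_eq (o : ι) (v : ι → ℂ) (hv : ∑ a, ‖v a‖ ^ 2 = 1) :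
    ∃ V : Matrix.unitaryGroup ι ℂ, ∀ a, (V : Matrix ι ι ℂ) o a = v a := by
  let w : EuclideanSpace ℂ ι := WithLp.toLp 2 v
  have hw : ‖w‖ = 1 := by
    simp [EuclideanSpace.norm_eq, w, hv]
  obtain ⟨b, hb⟩ := Orthonormal.exists_orthonormalBasis_extension_of_card_eq
    (𝕜 := ℂ) (E := EuclideanSpace ℂ ι) (ι := ι) (by simp) (v := fun _ => w) (s := {o}) (by
      refine ⟨fun _ => hw, fun x y hxy => (hxy (Subsingleton.elim x y)).elim⟩)
  refine ⟨⟨Matrix.of fun a c => b a c, Matrix.mem_unitaryGroup_iff.mpr ?_⟩, fun a => ?_⟩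
  · ext a c
    have := orthonormal_iff_ite.mp b.orthonormal c a
    rw [PiLp.inner_apply] at this
    simpa [Matrix.mul_apply, Matrix.one_apply, eq_comm] using this
  · simp [hb o rfl, w]

@[fun_prop]
theorem continuous_unitaryGroup_entry (a b : ι) :
    Continuous fun U : Matrix.unitaryGroup ι ℂ => (U : Matrix ι ι ℂ) a b :=
  continuous_subtype_val.matrix_elem a b

variable [MeasurableSpace (Matrix.unitaryGroup ι ℂ)] [BorelSpace (Matrix.unitaryGroup ι ℂ)]
  {μ : Measure (Matrix.unitaryGroup ι ℂ)}

theorem integrable_unitaryGroup_of_continuous [IsFiniteMeasure μ]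
    {f : Matrix.unitaryGroup ι ℂ → ℂ} (hf : Continuous f) : Integrable f μ := by
  have : CompactSpace (Matrix.unitaryGroup ι ℂ) :=
    isCompact_iff_compactSpace.mp isCompact_unitaryGroup
  exact hf.integrable_of_hasCompactSupport (HasCompactSupport.of_compactSpace f)

theorem integral_unitaryGroup_mul_left (hinv : ∀ V, μ.map (fun U => V * U) = μ)
    (V : Matrix.unitaryGroup ι ℂ) {f : Matrix.unitaryGroup ι ℂ → ℂ} (hf : Continuous f) :
    ∫ U, f (V * U) ∂μ = ∫ U, f U ∂μ := by
  conv_rhs => rw [← hinv V]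
  exact (integral_map (by fun_prop) hf.aestronglyMeasurable).symm

/-- Mixed moment of the entries of column `o` of a random unitary matrix. -/
noncomputable def columnMoment (μ : Measure (Matrix.unitaryGroup ι ℂ)) (o : ι)
    (α β : ι → ℕ) : ℂ :=
  ∫ U : Matrix.unitaryGroup ι ℂ, (∏ a, (U : Matrix ι ι ℂ) a o ^ α a) *
    (starRingEnd ℂ) (∏ a, (U : Matrix ι ι ℂ) a o ^ β a) ∂μ

theorem columnMoment_eq_zero (hinv : ∀ V, μ.map (fun U => V * U) = μ) (o : ι) {α β : ι → ℕ}
    (h : α ≠ β) : columnMoment μ o α β = 0 := by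
  obtain ⟨c, hc⟩ := Function.ne_iff.mp h
  have hsub : (α c : ℂ) - β c ≠ 0 := sub_ne_zero.mpr (by exact_mod_cast hc)
  let r : ℝ := Real.pi / (α c - β c)
  let z : ℂ := Complex.exp (r * Complex.I)
  have hz : (starRingEnd ℂ) z = Complex.exp (-(r * Complex.I)) := by
    simp [z, ← Complex.exp_conj]
  have hzz : z * (starRingEnd ℂ) z = 1 := by
    rw [hz, ← Complex.exp_add, add_neg_cancel, Complex.exp_zero]
  have hzpow : z ^ α c * (starRingEnd ℂ) z ^ β c = -1 := by
    rw [hz, ← Complex.exp_nat_mul, ← Complex.exp_nat_mul, ← Complex.exp_add, ← Complex.exp_pi_mul_I]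
    congr 1
    simp only [r]
    push_cast
    field_simp
    ring
  let V : Matrix.unitaryGroup ι ℂ :=
    ⟨Matrix.diagonal fun a => if a = c then z else 1, Matrix.mem_unitaryGroup_iff.mpr (by
      rw [Matrix.star_eq_conjTranspose, Matrix.diagonal_conjTranspose, Matrix.diagonal_mul_diagonal,
        ← Matrix.diagonal_one]
      congr 1
      funext a
      by_cases ha : a = c
      · simpa [ha] using hzz
      · simp [ha])⟩
  have hentry (U : Matrix.unitaryGroup ι ℂ) (a : ι) :
      ((V * U : Matrix.unitaryGroup ι ℂ) : Matrix ι ι ℂ) a o =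
        (if a = c then z else 1) * (U : Matrix ι ι ℂ) a o := by
    simp [V, Matrix.diagonal_mul]
  have hneg : columnMoment μ o α β = -1 * columnMoment μ o α β := by
    conv_lhs => rw [columnMoment, ← integral_unitaryGroup_mul_left hinv V (f := fun U =>
      (∏ a, (U : Matrix ι ι ℂ) a o ^ α a) *
        (starRingEnd ℂ) (∏ a, (U : Matrix ι ι ℂ) a o ^ β a)) (by fun_prop)]
    rw [columnMoment, ← integral_const_mul, ← hzpow]
    refine integral_congr_ae (.of_forall fun U => ?_)
    simp only [hentry, mul_pow, Finset.prod_mul_distrib, ite_pow, one_pow, Finset.prod_ite_eq',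
      mem_univ, if_true, map_mul, map_pow]
    ring
  linear_combination hneg / 2

/-- Moments of linear functionals with positive coefficients. -/
theorem integral_linear_pow (hinv : ∀ V, μ.map (fun U => V * U) = μ) (o : ι) (K : ℕ)
    {t : ι → ℝ} (ht : ∀ a, 0 < t a) :
    ∫ U : Matrix.unitaryGroup ι ℂ, (∑ a, (√(t a) : ℂ) * (U : Matrix ι ι ℂ) a o) ^ K *
      (starRingEnd ℂ) ((∑ a, (√(t a) : ℂ) * (U : Matrix ι ι ℂ) a o) ^ K) ∂μ =
    (∑ a, (t a : ℂ)) ^ K * ∫ U : Matrix.unitaryGroup ι ℂ, (U : Matrix ι ι ℂ) o o ^ K *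
      (starRingEnd ℂ) ((U : Matrix ι ι ℂ) o o ^ K) ∂μ := by
  have hs : 0 < ∑ a, t a := Finset.sum_pos (fun a _ => ht a) ⟨o, mem_univ o⟩
  set s := ∑ a, t a with hs_def
  obtain ⟨V, hV⟩ := exists_unitary_row_eq o (fun a => ((√(t a) / √s : ℝ) : ℂ)) (by
    simp only [Complex.norm_real, Real.norm_eq_abs, sq_abs, div_pow, Real.sq_sqrt hs.le,
      Real.sq_sqrt (ht _).le]
    rw [← Finset.sum_div, div_self hs.ne'])
  rw [← integral_unitaryGroup_mul_left hinv V (f := fun U => (U : Matrix ι ι ℂ) o o ^ K *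
      (starRingEnd ℂ) ((U : Matrix ι ι ℂ) o o ^ K)) (by fun_prop), ← integral_const_mul]
  refine integral_congr_ae (.of_forall fun U => ?_)
  have hsq : (√s : ℂ) ≠ 0 := by exact_mod_cast (Real.sqrt_pos.mpr hs).ne'
  have hlin : ∑ a, (√(t a) : ℂ) * (U : Matrix ι ι ℂ) a o =
      √s * ((V * U : Matrix.unitaryGroup ι ℂ) : Matrix ι ι ℂ) o o := by
    simp only [Submonoid.coe_mul, Matrix.mul_apply, hV, Finset.mul_sum]
    refine Finset.sum_congr rfl fun a _ => ?_
    push_cast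
    field_simp
  have hss : (√s : ℂ) * √s = ∑ a, (t a : ℂ) := by
    rw [← Complex.ofReal_mul, Real.mul_self_sqrt hs.le, hs_def, Complex.ofReal_sum]
  simp only [hlin, map_pow, map_mul, Complex.conj_ofReal, ← hss]
  ring

theorem integral_linear_pow_eq_sum [IsFiniteMeasure μ] (hinv : ∀ V, μ.map (fun U => V * U) = μ)
    (o : ι) (K : ℕ) {t : ι → ℝ} (ht : ∀ a, 0 < t a) :
    ∫ U : Matrix.unitaryGroup ι ℂ, (∑ a, (√(t a) : ℂ) * (U : Matrix ι ι ℂ) a o) ^ K *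
      (starRingEnd ℂ) ((∑ a, (√(t a) : ℂ) * (U : Matrix ι ι ℂ) a o) ^ K) ∂μ =
    ∑ α ∈ piAntidiag univ K, ((Nat.multinomial univ α : ℂ) ^ 2 * columnMoment μ o α α) *
      ∏ a, (t a : ℂ) ^ α a := by
  have hexp (U : Matrix.unitaryGroup ι ℂ) :
      (∑ a, (√(t a) : ℂ) * (U : Matrix ι ι ℂ) a o) ^ K *
        (starRingEnd ℂ) ((∑ a, (√(t a) : ℂ) * (U : Matrix ι ι ℂ) a o) ^ K) =
      ∑ α ∈ piAntidiag univ K, ∑ β ∈ piAntidiag univ K,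
        ((Nat.multinomial univ α : ℂ) * (Nat.multinomial univ β : ℂ) *
          ((∏ a, (√(t a) : ℂ) ^ α a) * ∏ a, (√(t a) : ℂ) ^ β a)) *
        ((∏ a, (U : Matrix ι ι ℂ) a o ^ α a) *
          (starRingEnd ℂ) (∏ a, (U : Matrix ι ι ℂ) a o ^ β a)) := by
    rw [Finset.sum_pow_eq_sum_piAntidiag, map_sum, Finset.sum_mul_sum]
    refine Finset.sum_congr rfl fun α _ => Finset.sum_congr rfl fun β _ => ?_
    simp only [mul_pow, Finset.prod_mul_distrib, map_mul, map_prod, map_pow, Complex.conj_ofReal,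
      map_natCast]
    ring
  simp only [hexp]
  rw [integral_finsetSum _ fun α _ => integrable_unitaryGroup_of_continuous (by fun_prop)]
  refine Finset.sum_congr rfl fun α hα => ?_
  rw [integral_finsetSum _ fun β _ => integrable_unitaryGroup_of_continuous (by fun_prop)]
  simp only [integral_const_mul]
  rw [Finset.sum_eq_single_of_mem α hα fun β _ hβ => ?_]
  · rw [← Finset.prod_mul_distrib]
    have : ∀ a, (√(t a) : ℂ) ^ α a * (√(t a) : ℂ) ^ α a = (t a : ℂ) ^ α a := fun a => by
      rw [← mul_pow, ← Complex.ofReal_mul, Real.mul_self_sqrt (ht a).le]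
    simp only [this, columnMoment]
    ring
  · exact mul_eq_zero_of_right _ (columnMoment_eq_zero hinv o hβ.symm)

/-- Every `columnMoment μ o α α` with `∑ a, α a = K` is inversely proportional to the multinomial
coefficient of `α`. -/
theorem multinomial_mul_columnMoment [IsProbabilityMeasure μ]
    (hinv : ∀ V, μ.map (fun U => V * U) = μ) (o : ι) {K : ℕ} {α : ι → ℕ} (hα : ∑ a, α a = K) :
    (Nat.multinomial univ α : ℂ) * columnMoment μ o α α =
      ((Fintype.card ι).multichoose K : ℂ)⁻¹ := by
  set c : ℂ := ∫ U : Matrix.unitaryGroup ι ℂ, (U : Matrix ι ι ℂ) o o ^ K *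
      (starRingEnd ℂ) ((U : Matrix ι ι ℂ) o o ^ K) ∂μ
  have hprop : ∀ α ∈ piAntidiag (univ : Finset ι) K,
      (Nat.multinomial univ α : ℂ) * columnMoment μ o α α = c := by
    intro α hα
    have hcoeff := coeff_eq_of_eval_pos_eq (S := piAntidiag univ K)
      (A := fun α => (Nat.multinomial univ α : ℂ) ^ 2 * columnMoment μ o α α)
      (B := fun α => (Nat.multinomial univ α : ℂ) * c) (fun t ht => by
        rw [← integral_linear_pow_eq_sum hinv o K ht, integral_linear_pow hinv o K ht,
          Finset.sum_pow_eq_sum_piAntidiag, Finset.sum_mul]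
        exact Finset.sum_congr rfl fun _ _ => by ring) hα
    have hne : (Nat.multinomial univ α : ℂ) ≠ 0 := by
      exact_mod_cast (Nat.multinomial_pos univ α).ne'
    refine mul_left_cancel₀ hne ?_
    linear_combination hcoeff
  have hcol (U : Matrix.unitaryGroup ι ℂ) :
      ∑ a, (U : Matrix ι ι ℂ) a o * (starRingEnd ℂ) ((U : Matrix ι ι ℂ) a o) = 1 := by
    have := congrFun (congrFun (Matrix.mem_unitaryGroup_iff'.mp U.2) o) o
    simpa [Matrix.mul_apply, mul_comm] using this
  have hsum : ∑ α ∈ piAntidiag (univ : Finset ι) K,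
      (Nat.multinomial univ α : ℂ) * columnMoment μ o α α = 1 := by
    simp only [columnMoment, ← integral_const_mul]
    rw [← integral_finsetSum _ fun α _ => integrable_unitaryGroup_of_continuous (by fun_prop)]
    have : ∀ U : Matrix.unitaryGroup ι ℂ, ∑ α ∈ piAntidiag (univ : Finset ι) K,
        (Nat.multinomial univ α : ℂ) * ((∏ a, (U : Matrix ι ι ℂ) a o ^ α a) *
          (starRingEnd ℂ) (∏ a, (U : Matrix ι ι ℂ) a o ^ α a)) = 1 := fun U => by
      rw [← one_pow K, ← hcol U, Finset.sum_pow_eq_sum_piAntidiag]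
      simp only [map_prod, map_pow, mul_pow, Finset.prod_mul_distrib]
    simp only [this, integral_const, probReal_univ, one_smul]
  rw [Finset.sum_congr rfl hprop, Finset.sum_const, card_piAntidiag_univ, nsmul_eq_mul] at hsum
  rw [hprop α (by simpa using hα)]
  exact eq_inv_of_mul_eq_one_right hsum

end UnitaryGroup

/-- **Haar integration over the symmetric subspace**:
`E_ψ (|ψ⟩⟨ψ|)^{⊗K} = (Σ_{π ∈ S_K} π) / (d(d+1)⋯(d+K−1))` for a Haar-random pure state
`ψ = U e`, stated entrywise.  The `K`-fold Kronecker power `((Ue)(Ue)ᴴ)^{⊗K}` has rows and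
columns indexed by tuples `i : Fin K → Fin d`, with `(i, j)` entry
`∏ k, (Ue) (i k) * conj ((Ue) (j k))`, and `M_π` is the permutation operator with entries
`M_π[i, j] = 1` if `i k = j (π k)` for all `k`, and `0` otherwise.  The Haar probability
measure on `U(d)` is characterized as a left-translation-invariant Borel probability
measure. -/
theorem haar_integral_symmetric_subspace (d K : ℕ) (hd : 1 ≤ d) (hK : 1 ≤ K)
    [MeasurableSpace (Matrix.unitaryGroup (Fin d) ℂ)]
    [BorelSpace (Matrix.unitaryGroup (Fin d) ℂ)]
    (μ : Measure (Matrix.unitaryGroup (Fin d) ℂ)) [IsProbabilityMeasure μ]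
    (hinv : ∀ V : Matrix.unitaryGroup (Fin d) ℂ, μ.map (fun U => V * U) = μ) :
    ∀ i j : Fin K → Fin d,
      ∫ U : Matrix.unitaryGroup (Fin d) ℂ,
          ∏ k, ((U : Matrix (Fin d) (Fin d) ℂ) (i k) ⟨0, hd⟩ *
            (starRingEnd ℂ) ((U : Matrix (Fin d) (Fin d) ℂ) (j k) ⟨0, hd⟩)) ∂μ =
        (1 / ∏ m : Fin K, ((d : ℂ) + m)) *
          ∑ π : Equiv.Perm (Fin K), (if ∀ k, i k = j (π k) then (1 : ℂ) else 0) := by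
  intro i j
  have hmoment : ∫ U : Matrix.unitaryGroup (Fin d) ℂ,
      ∏ k, ((U : Matrix (Fin d) (Fin d) ℂ) (i k) ⟨0, hd⟩ *
        (starRingEnd ℂ) ((U : Matrix (Fin d) (Fin d) ℂ) (j k) ⟨0, hd⟩)) ∂μ =
      columnMoment μ ⟨0, hd⟩ (fun a => #{k | i k = a}) (fun a => #{k | j k = a}) := by
    refine integral_congr_ae (.of_forall fun U => ?_)
    simp only [Finset.prod_mul_distrib, map_prod, map_pow]
    rw [prod_comp_eq_prod_pow_card_fiber (fun a => (U : Matrix (Fin d) (Fin d) ℂ) a ⟨0, hd⟩),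
      prod_comp_eq_prod_pow_card_fiber
        (fun a => (starRingEnd ℂ) ((U : Matrix (Fin d) (Fin d) ℂ) a ⟨0, hd⟩))]
  rw [hmoment]
  by_cases h : (fun a => #{k | i k = a}) = fun a => #{k | j k = a}
  · rw [h, sum_perm_eq_prod_factorial (congrFun h), prod_cast_add_eq_factorial_mul_multichoose]
    have hsum : ∑ a, #{k | j k = a} = K := by
      simpa using (Finset.card_eq_sum_card_fiberwise (f := j) (s := univ) (t := univ)
        (by simp)).symm
    have hmom := multinomial_mul_columnMoment hinv ⟨0, hd⟩ hsum
    have hspec : (∏ a, ((#{k | j k = a}).factorial : ℂ)) *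
        Nat.multinomial univ (fun a => #{k | j k = a}) = K.factorial := by
      have := Nat.multinomial_spec univ fun a => #{k | j k = a}
      rw [hsum] at this
      exact_mod_cast this
    have hK0 : (K.factorial : ℂ) ≠ 0 := by exact_mod_cast K.factorial_ne_zero
    rw [Fintype.card_fin] at hmom
    rw [one_div, mul_inv, ← hmom]
    field_simp
    linear_combination -columnMoment μ ⟨0, hd⟩ (fun a => #{k | j k = a})
      (fun a => #{k | j k = a}) * hspec
  · rw [sum_perm_eq_zero h, columnMoment_eq_zero hinv _ h, mul_zero]
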